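/- Let α ∈ (0,1), λ > 0, T > 0, and let c₀ be a positive constant with c₀ < (1/2)(λ Γ(2−α))^{−1/α}. Then there exist constants C₁, C₂ > 0, depending only on α, λ, T, c₀, such that for every temporal mesh on [0,T] with max_{j} τ_j ≤ c₀/2 and every mesh index m ∈ {0,…,M}, there exists a real sequence (B^j)_{j=0}^M satisfying: B^j = 0 for all j ≤ m; 0 ≤ B^j ≤ C₁ for all j = 0,…,M; (δ_t^α B^j) − λ B^j ≥ 0 for all j ∈ {1,…,M} with t_j < t_m + c₀; and (δ_t^α B^j) − λ B^j ≥ C₂ for all j ∈ {1,…,M} with t_j ≥ t_m + c₀. -/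

import Mathlib

open Real MeasureTheory

/-- The L1 discrete Caputo operator of order `α` on the temporal mesh `t`. -/
noncomputable def deltaL1 (α : ℝ) (t : ℕ → ℝ) (V : ℕ → ℝ) (m : ℕ) : ℝ :=
  (1 / Real.Gamma (1 - α)) *
    ∑ j ∈ Finset.Icc 1 m,
      ((V j - V (j - 1)) / (t j - t (j - 1))) *
        ∫ s in (t (j - 1))..(t j), (t m - s) ^ (-α)

theorem int_aux (α : ℝ) (hα : α ∈ Set.Ioo (0 : ℝ) 1) (x a b : ℝ) :
    ∫ s in a..b, (x - s) ^ (-α) = ((x - a) ^ (1 - α) - (x - b) ^ (1 - α)) / (1 - α) := by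
  rw [intervalIntegral.integral_comp_sub_left (fun s => s ^ (-α)) x,
    integral_rpow (Or.inl (by linarith [hα.2]))]
  rw [show -α + 1 = 1 - α by ring]

theorem sum_aux (α : ℝ) (hα : α ∈ Set.Ioo (0 : ℝ) 1) (M : ℕ) (t : ℕ → ℝ)
    (hmono : ∀ j, j < M → t j < t (j + 1)) (m : ℕ) (x : ℝ) (k : ℕ) (hk : k ≤ M) :
    ∑ j ∈ Finset.Icc 1 k,
      (((t (max j m) - t m) - (t (max (j - 1) m) - t m)) / (t j - t (j - 1))) *
        ∫ s in (t (j - 1))..(t j), (x - s) ^ (-α)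
    = ((x - t m) ^ (1 - α) - (x - t (max k m)) ^ (1 - α)) / (1 - α) := by
  induction k with
  | zero => simp
  | succ k ih =>
    rw [Finset.sum_Icc_succ_top (by omega), ih (by omega), int_aux α hα]
    simp only [Nat.add_sub_cancel]
    have h1 := hmono k (by omega)
    rcases le_or_gt (k + 1) m with h | h
    · rw [max_eq_right h, max_eq_right (show k ≤ m by omega)]
      simp
    · rw [max_eq_left (show m ≤ k + 1 by omega), max_eq_left (show m ≤ k by omega)]
      rw [show t (k+1) - t m - (t k - t m) = t (k+1) - t k by ring,
        div_self (by linarith)]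
      ring

theorem delta_lin (α : ℝ) (t V W : ℕ → ℝ) (K : ℝ) (j : ℕ) :
    deltaL1 α t (fun i => V i + K * W i) j = deltaL1 α t V j + K * deltaL1 α t W j := by
  unfold deltaL1
  rw [mul_left_comm K, ← mul_add]
  congr 1
  rw [Finset.mul_sum, ← Finset.sum_add_distrib]
  apply Finset.sum_congr rfl
  intro i _
  ring

theorem delta_B1 (α : ℝ) (hα : α ∈ Set.Ioo (0 : ℝ) 1) (M : ℕ) (t : ℕ → ℝ)
    (hmono : ∀ j, j < M → t j < t (j + 1)) (m : ℕ) (j : ℕ) (hj : j ≤ M) :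
    deltaL1 α t (fun i => t (max i m) - t m) j
      = (t (max j m) - t m) ^ (1 - α) / Real.Gamma (2 - α) := by
  unfold deltaL1
  rw [sum_aux α hα M t hmono m (t j) j hj]
  have hG : Real.Gamma (2 - α) = (1 - α) * Real.Gamma (1 - α) := by
    rw [← Real.Gamma_add_one (by linarith [hα.2])]; ring_nf
  have h0 : (0:ℝ) ^ (1 - α) = 0 := Real.zero_rpow (by linarith [hα.2])
  rw [hG]
  rcases le_or_gt j m with h | h
  · rw [max_eq_right h]; simp [h0]
  · rw [max_eq_left h.le]; simp only [sub_self, h0, sub_zero]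
    rw [div_mul_div_comm, one_mul, mul_comm (Gamma _)]

theorem q_pos (α lam c₀ : ℝ)
    (hα : α ∈ Set.Ioo (0 : ℝ) 1) (hlam : 0 < lam) (hc₀ : 0 < c₀)
    (hc₀' : c₀ < (1 / 2) * (lam * Real.Gamma (2 - α)) ^ (-(1 / α))) :
    0 < (2 * c₀) ^ (-α) / Real.Gamma (2 - α) - lam := by
  have hG : 0 < Real.Gamma (2 - α) := Real.Gamma_pos_of_pos (by linarith [hα.2])
  have hp : 0 < lam * Real.Gamma (2 - α) := by positivity
  have h := Real.rpow_lt_rpow_of_neg (z := -α) (by positivity : 0 < 2 * c₀)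
    (show 2 * c₀ < (lam * Real.Gamma (2 - α)) ^ (-(1 / α)) by linarith) (by linarith [hα.1])
  rw [← Real.rpow_mul hp.le, show -(1 / α) * -α = 1 by
    have := hα.1.ne'; field_simp, Real.rpow_one] at h
  rw [sub_pos, lt_div_iff₀ hG]; exact h

theorem resid (α lam c₀ x : ℝ)
    (hα : α ∈ Set.Ioo (0 : ℝ) 1) (hx0 : 0 ≤ x) (hx : x ≤ 2 * c₀) :
    x * ((2 * c₀) ^ (-α) / Real.Gamma (2 - α) - lam)
      ≤ x ^ (1 - α) / Real.Gamma (2 - α) - lam * x := by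
  have hG : 0 < Real.Gamma (2 - α) := Real.Gamma_pos_of_pos (by linarith [hα.2])
  rcases hx0.eq_or_lt with rfl | hx0
  · rw [Real.zero_rpow (by linarith [hα.2])]; simp
  · have h1 : (2 * c₀) ^ (-α) ≤ x ^ (-α) :=
      Real.rpow_le_rpow_of_nonpos hx0 hx (by linarith [hα.1])
    have h2 : x ^ (1 - α) = x * x ^ (-α) := by
      rw [sub_eq_add_neg, Real.rpow_add hx0, Real.rpow_one]
    rw [h2]
    have h3 : x * (2 * c₀) ^ (-α) / Real.Gamma (2 - α) ≤ x * x ^ (-α) / Real.Gamma (2 - α) := by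
      gcongr
    calc _ = x * (2 * c₀) ^ (-α) / Real.Gamma (2 - α) - lam * x := by ring
      _ ≤ _ := by linarith

theorem mesh_le (M : ℕ) (t : ℕ → ℝ) (hmono : ∀ j, j < M → t j < t (j + 1))
    (i j : ℕ) (hij : i ≤ j) (hj : j ≤ M) : t i ≤ t j := by
  induction j, hij using Nat.le_induction with
  | base => exact le_rfl
  | succ k hk ih => exact (ih (by omega)).trans (hmono k (by omega)).le

theorem main_ind (α lam T c₀ : ℝ)
    (hα : α ∈ Set.Ioo (0 : ℝ) 1) (hlam : 0 < lam) (hT : 0 < T)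
    (hc₀ : 0 < c₀)
    (hc₀' : c₀ < (1 / 2) * (lam * Real.Gamma (2 - α)) ^ (-(1 / α))) (n : ℕ) :
    ∃ C₁ > (0 : ℝ), ∃ C₂ > (0 : ℝ), ∀ (M : ℕ) (t : ℕ → ℝ),
      1 ≤ M → t 0 = 0 → t M = T →
      (∀ j, j < M → t j < t (j + 1)) →
      (∀ j, 1 ≤ j → j ≤ M → t j - t (j - 1) ≤ c₀ / 2) →
      ∀ m, m ≤ M →
      ∃ B : ℕ → ℝ,
        (∀ j, j ≤ m → B j = 0) ∧
        (∀ j, j ≤ M → 0 ≤ B j ∧ B j ≤ C₁) ∧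
        (∀ j, 1 ≤ j → j ≤ M → t j ≤ t m + n * (c₀ / 2) →
          0 ≤ deltaL1 α t B j - lam * B j) ∧
        (∀ j, 1 ≤ j → j ≤ M → t j ≤ t m + n * (c₀ / 2) → t m + c₀ ≤ t j →
          C₂ ≤ deltaL1 α t B j - lam * B j) := by
  induction n with
  | zero =>
    refine ⟨1, one_pos, 1, one_pos, ?_⟩
    intro M t hM h0 hTM hmono hstep m hm
    refine ⟨fun _ => 0, by simp, by simp, ?_, ?_⟩
    · intro j _ _ _; simp [deltaL1]
    · intro j _ _ h1 h2
      push_cast at h1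
      linarith
  | succ n ih =>
    obtain ⟨D₁, hD₁, D₂, hD₂, H⟩ := ih
    have hq := q_pos α lam c₀ hα hlam hc₀ hc₀'
    have hres := fun x => resid α lam c₀ x hα
    set q := (2 * c₀) ^ (-α) / Real.Gamma (2 - α) - lam with hqdef
    set K := (lam * T + 1) / D₂ with hK
    have hKpos : 0 < K := by positivity
    have hKD : K * D₂ = lam * T + 1 := by rw [hK]; field_simp
    have hG : 0 < Real.Gamma (2 - α) := Real.Gamma_pos_of_pos (by linarith [hα.2])
    refine ⟨T + K * D₁, by positivity, min 1 (c₀ * q), by positivity, ?_⟩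
    intro M t hM h0 hTM hmono hstep m hm
    have hle := mesh_le M t hmono
    have hmax : ∀ j, j ≤ M → max j m ≤ M := fun j hj => max_le hj hm
    have hb0 : ∀ j, j ≤ M → 0 ≤ t (max j m) - t m := fun j hj =>
      sub_nonneg.2 (hle _ _ (le_max_right _ _) (hmax j hj))
    have htm0 : 0 ≤ t m := h0 ▸ hle 0 m (Nat.zero_le _) hm
    have hbT : ∀ j, j ≤ M → t (max j m) - t m ≤ T := fun j hj => by
      have := hle _ _ (hmax j hj) le_rfl
      linarith
    have hbx : ∀ j, j ≤ M → t m ≤ t j → t (max j m) = t j := fun j hj h => by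
      rcases le_or_gt j m with h' | h'
      · rw [max_eq_right h']; exact le_antisymm h (hle _ _ h' hm)
      · rw [max_eq_left h'.le]
    have hb2 : ∀ j, j ≤ M → t j ≤ t m + 2 * c₀ → t (max j m) - t m ≤ 2 * c₀ := fun j hj h => by
      rcases le_or_gt j m with h' | h'
      · rw [max_eq_right h']; linarith
      · rw [max_eq_left h'.le]; linarith
    have hdel := fun j hj => delta_B1 α hα M t hmono m j hj
    have hdel0 : ∀ j, j ≤ M → 0 ≤ deltaL1 α t (fun i => t (max i m) - t m) j := fun j hj => by
      rw [hdel j hj]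
      exact div_nonneg (Real.rpow_nonneg (hb0 j hj) _) hG.le
    have hr1 : ∀ j, j ≤ M → t j ≤ t m + 2 * c₀ →
        0 ≤ deltaL1 α t (fun i => t (max i m) - t m) j - lam * (t (max j m) - t m) := by
      intro j hj h
      rw [hdel j hj]
      exact (mul_nonneg (hb0 j hj) hq.le).trans (hres _ (hb0 j hj) (hb2 j hj h))
    have hr2 : ∀ j, j ≤ M → t j ≤ t m + 2 * c₀ → t m + c₀ ≤ t j →
        c₀ * q ≤ deltaL1 α t (fun i => t (max i m) - t m) j - lam * (t (max j m) - t m) := by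
      intro j hj h h'
      rw [hdel j hj]
      refine le_trans ?_ (hres _ (hb0 j hj) (hb2 j hj h))
      apply mul_le_mul_of_nonneg_right _ hq.le
      rw [hbx j hj (by linarith)]; linarith
    by_cases hex : ∃ k, k ≤ M ∧ t m + c₀ / 2 ≤ t k
    · classical
      obtain ⟨hk1, hk2⟩ := Nat.find_spec hex
      have hmin := fun i => Nat.find_min hex (m := i)
      set k := Nat.find hex
      have hmk : m < k := by
        by_contra hcon
        have := hle k m (by omega) hm
        linarith
      have hkub : t k ≤ t m + c₀ := by
        have h1 := hmin (k - 1) (by omega)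
        have h2 := hstep k (by omega) hk1
        have h3 : t (k - 1) < t m + c₀ / 2 := by
          by_contra hcon
          exact h1 ⟨by omega, not_lt.1 hcon⟩
        linarith
      obtain ⟨W, hW0, hWb, hW1, hW2⟩ := H M t hM h0 hTM hmono hstep k hk1
      refine ⟨fun i => (t (max i m) - t m) + K * W i, ?_, ?_, ?_⟩
      · intro j hj
        simp [max_eq_right hj, hW0 j (by omega)]
      · intro j hj
        have h1 := hb0 j hj
        have h2 := hbT j hj
        obtain ⟨h3, h4⟩ := hWb j hj
        have h5 := mul_nonneg hKpos.le h3
        have h6 := mul_le_mul_of_nonneg_left h4 hKpos.le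
        exact ⟨by simp only; linarith, by simp only; linarith⟩
      · have key : ∀ j, 1 ≤ j → j ≤ M → t j ≤ t m + ((n + 1 : ℕ) : ℝ) * (c₀ / 2) →
            t m + 2 * c₀ < t j → 1 ≤ deltaL1 α t (fun i => (t (max i m) - t m) + K * W i) j
              - lam * ((t (max j m) - t m) + K * W j) := by
          intro j hj1 hj h h'
          push_cast at h
          rw [delta_lin]
          have h1 := hW2 j hj1 hj (by linarith) (by linarith)
          have h2 := mul_le_mul_of_nonneg_left h1 hKpos.le
          have h3 := hdel0 j hj
          have h4 := mul_le_mul_of_nonneg_left (hbT j hj) hlam.le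
          linarith
        have key2 : ∀ j, 1 ≤ j → j ≤ M → t j ≤ t m + ((n + 1 : ℕ) : ℝ) * (c₀ / 2) →
            deltaL1 α t (fun i => t (max i m) - t m) j - lam * (t (max j m) - t m)
            ≤ deltaL1 α t (fun i => (t (max i m) - t m) + K * W i) j
              - lam * ((t (max j m) - t m) + K * W j) := by
          intro j hj1 hj h
          push_cast at h
          rw [delta_lin]
          have h1 := mul_nonneg hKpos.le (hW1 j hj1 hj (by linarith))
          linarith
        constructor
        · intro j hj1 hj h
          rcases le_or_gt (t j) (t m + 2 * c₀) with h' | h'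
          · exact (hr1 j hj h').trans (key2 j hj1 hj h)
          · exact zero_le_one.trans (key j hj1 hj h h')
        · intro j hj1 hj h hc
          rcases le_or_gt (t j) (t m + 2 * c₀) with h' | h'
          · exact (min_le_right _ _).trans ((hr2 j hj h' hc).trans (key2 j hj1 hj h))
          · exact (min_le_left _ _).trans (key j hj1 hj h h')
    · push Not at hex
      refine ⟨fun i => t (max i m) - t m, ?_, ?_, ?_, ?_⟩
      · intro j hj
        simp [max_eq_right hj]
      · intro j hj
        have := mul_pos hKpos hD₁
        exact ⟨hb0 j hj, by linarith [hbT j hj]⟩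
      · intro j _ hj _
        exact hr1 j hj (by linarith [hex j hj])
      · intro j _ hj _ h
        linarith [hex j hj]

theorem stmt6
    (α lam T c₀ : ℝ)
    (hα : α ∈ Set.Ioo (0 : ℝ) 1) (hlam : 0 < lam) (hT : 0 < T)
    (hc₀ : 0 < c₀)
    (hc₀' : c₀ < (1 / 2) * (lam * Real.Gamma (2 - α)) ^ (-(1 / α))) :
    ∃ C₁ > (0 : ℝ), ∃ C₂ > (0 : ℝ), ∀ (M : ℕ) (t : ℕ → ℝ),
      1 ≤ M → t 0 = 0 → t M = T →
      (∀ j, j < M → t j < t (j + 1)) →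
      (∀ j, 1 ≤ j → j ≤ M → t j - t (j - 1) ≤ c₀ / 2) →
      ∀ m, m ≤ M →
      ∃ B : ℕ → ℝ,
        (∀ j, j ≤ m → B j = 0) ∧
        (∀ j, j ≤ M → 0 ≤ B j ∧ B j ≤ C₁) ∧
        (∀ j, 1 ≤ j → j ≤ M → t j < t m + c₀ →
          0 ≤ deltaL1 α t B j - lam * B j) ∧
        (∀ j, 1 ≤ j → j ≤ M → t m + c₀ ≤ t j →
          C₂ ≤ deltaL1 α t B j - lam * B j) := by
  obtain ⟨n, hn⟩ := exists_nat_ge (T / (c₀ / 2))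
  have hn' : T ≤ n * (c₀ / 2) := (div_le_iff₀ (by positivity)).1 hn
  obtain ⟨C₁, h1, C₂, h2, H⟩ := main_ind α lam T c₀ hα hlam hT hc₀ hc₀' n
  refine ⟨C₁, h1, C₂, h2, ?_⟩
  intro M t hM h0 hTM hmono hstep m hm
  obtain ⟨B, hB0, hBb, hB1, hB2⟩ := H M t hM h0 hTM hmono hstep m hm
  have hle := mesh_le M t hmono
  have htm0 : 0 ≤ t m := h0 ▸ hle 0 m (Nat.zero_le _) hm
  have hr : ∀ j, j ≤ M → t j ≤ t m + n * (c₀ / 2) := fun j hj => by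
    have := hle j M hj le_rfl
    linarith
  exact ⟨B, hB0, hBb, fun j hj1 hj _ => hB1 j hj1 hj (hr j hj),
    fun j hj1 hj h => hB2 j hj1 hj (hr j hj) h⟩
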